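/- Let p ∈ (2,∞), r ∈ (1/p, 1/2), and α = 2r − 1. Let f(x) = (−1)^{⌊−log₂ x⌋} x^{−1/(p−1)} (1 − log₂ x)^{−r}, σ(x) = x^{1/(p−1)}, w(x) = 1/(x (1 − log₂ x)^{1−α}) for x ∈ (0,1) (f(0)=σ(0)=w(0)=1). Then ∫_{[0, 2^{−k})} S(σf)(x)^p w(x) dx → ∞ as k → ∞; in particular S(σf) ∉ L^p(w), where S is the dyadic square function over [0,1). Combined with f ∈ L^p(σ), [w,σ]_{A_p} < ∞ and [σ]_{A_∞} < ∞, this gives an explicit counterexample showing no bound ‖S(·σ)‖_{L^p(σ)→L^p(w)} ≲ [w,σ]_{A_p}^{1/p} ψ([σ]_{A_∞}) can hold for p > 2. -/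

import Mathlib

open MeasureTheory Set Filter
open scoped ENNReal NNReal

noncomputable section

/-- Average of `g` over the interval `[a, b)` (with respect to Lebesgue measure). -/
def avgI (g : ℝ → ℝ) (a b : ℝ) : ℝ := (b - a)⁻¹ * ∫ x in Set.Ico a b, g x

/-- The dyadic interval `[k·2^{-n}, (k+1)·2^{-n})`. -/
def dyadicI (n k : ℤ) : Set ℝ :=
  Set.Ico ((k : ℝ) * (2:ℝ) ^ (-n)) (((k : ℝ) + 1) * (2:ℝ) ^ (-n))

/-- Average of `g` over the dyadic interval `dyadicI n k`. -/
def avgD (g : ℝ → ℝ) (n k : ℤ) : ℝ :=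
  avgI g ((k : ℝ) * (2:ℝ) ^ (-n)) (((k : ℝ) + 1) * (2:ℝ) ^ (-n))

/-- The martingale difference `Δ_Q g` associated with the dyadic interval `Q = dyadicI n k`:
`Δ_Q g = Σ_{R child of Q} ⟨g⟩_R 1_R − ⟨g⟩_Q 1_Q`. -/
def deltaD (g : ℝ → ℝ) (n k : ℤ) (x : ℝ) : ℝ :=
  (dyadicI (n+1) (2*k)).indicator (fun _ => avgD g (n+1) (2*k)) x
    + (dyadicI (n+1) (2*k+1)).indicator (fun _ => avgD g (n+1) (2*k+1)) x
    - (dyadicI n k).indicator (fun _ => avgD g n k) x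

/-- The dyadic square function on `ℝ`. -/
def sqFn (g : ℝ → ℝ) (x : ℝ) : ℝ :=
  Real.sqrt (∑' q : ℤ × ℤ, (deltaD g q.1 q.2 x) ^ 2)

open Classical in
/-- The dyadic square function over `[0,1)`: the sum runs only over dyadic intervals
contained in `[0,1)`. -/
def sqFn01 (g : ℝ → ℝ) (x : ℝ) : ℝ :=
  Real.sqrt (∑' q : ℤ × ℤ,
    if dyadicI q.1 q.2 ⊆ Set.Ico (0:ℝ) 1 then (deltaD g q.1 q.2 x) ^ 2 else 0)

/-- `‖g‖_{L^p(w)}` (as an extended nonnegative real), `w dx` being the underlying measure. -/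
def pNorm (p : ℝ) (g w : ℝ → ℝ) : ℝ≥0∞ :=
  (∫⁻ x : ℝ, ENNReal.ofReal (|g x| ^ p * w x)) ^ (1/p)

/-- `‖g‖_{L^p(w)}` over `[0,1)`. -/
def pNorm01 (p : ℝ) (g w : ℝ → ℝ) : ℝ≥0∞ :=
  (∫⁻ x in Set.Ico (0:ℝ) 1, ENNReal.ofReal (|g x| ^ p * w x)) ^ (1/p)

/-- The joint `A_p` characteristic `[w,σ]_{A_p}`, the supremum running over all bounded
intervals of `ℝ`. -/
def apChar (p : ℝ) (w σ : ℝ → ℝ) : ℝ≥0∞ :=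
  ⨆ (a : ℝ) (b : ℝ) (_ : a < b),
    ENNReal.ofReal (avgI w a b * (avgI σ a b) ^ (p - 1))

/-- The joint `A_p` characteristic `[w,σ]_{A_p}`, the supremum running over all
subintervals of `[0,1)`. -/
def apChar01 (p : ℝ) (w σ : ℝ → ℝ) : ℝ≥0∞ :=
  ⨆ (a : ℝ) (b : ℝ) (_ : 0 ≤ a) (_ : a < b) (_ : b ≤ 1),
    ENNReal.ofReal (avgI w a b * (avgI σ a b) ^ (p - 1))

/-- The local maximal function `M_{[a,b)} σ (x) = sup { ⟨σ⟩_R : R interval ⊆ [a,b), x ∈ R }`. -/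
def maxFn (σ : ℝ → ℝ) (a b x : ℝ) : ℝ≥0∞ :=
  ⨆ (c : ℝ) (e : ℝ) (_ : a ≤ c) (_ : c < e) (_ : e ≤ b) (_ : x ∈ Set.Ico c e),
    ENNReal.ofReal (avgI σ c e)

/-- The Fujii–Wilson `A_∞` characteristic
`[σ]_{A_∞} = sup_Q (1/σ(Q)) ∫_Q M_Q σ`, the supremum over bounded intervals of `ℝ`. -/
def ainfChar (σ : ℝ → ℝ) : ℝ≥0∞ :=
  ⨆ (a : ℝ) (b : ℝ) (_ : a < b),
    (∫⁻ x in Set.Ico a b, maxFn σ a b x) / ENNReal.ofReal (∫ x in Set.Ico a b, σ x)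

/-- A weight on `ℝ`: measurable, a.e. positive, integrable over every bounded interval. -/
def IsWeight (w : ℝ → ℝ) : Prop :=
  Measurable w ∧ (∀ᵐ x : ℝ, 0 < w x) ∧
    ∀ a b : ℝ, a < b → IntegrableOn w (Set.Ico a b)

/-- A weight on `[0,1)`: measurable, a.e. positive on `[0,1)`, integrable over `[0,1)`. -/
def IsWeight01 (w : ℝ → ℝ) : Prop :=
  Measurable w ∧ (∀ᵐ x : ℝ, x ∈ Set.Ico (0:ℝ) 1 → 0 < w x) ∧
    IntegrableOn w (Set.Ico (0:ℝ) 1)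

/-! ### Averages -/

lemma avgI_le_of_le {g : ℝ → ℝ} {a b M : ℝ} (hab : a < b) (hg : IntegrableOn g (Ico a b))
    (h : ∀ x ∈ Ioo a b, g x ≤ M) : avgI g a b ≤ M := by
  have h1 : ∫ x in Ico a b, g x ≤ ∫ _ in Ioo a b, M := by
    rw [integral_Ico_eq_integral_Ioo]
    exact setIntegral_mono_on (hg.mono_set Ioo_subset_Ico_self) (by simp) measurableSet_Ioo h
  have h2 : ∫ _ in Ioo a b, M = (b - a) * M := by
    simp [Measure.real, Real.volume_Ioo, hab.le]
  rw [h2] at h1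
  unfold avgI
  rw [inv_mul_le_iff₀ (sub_pos.2 hab)]
  exact h1

lemma le_avgI_of_le {g : ℝ → ℝ} {a b m : ℝ} (hab : a < b) (hg : IntegrableOn g (Ico a b))
    (h : ∀ x ∈ Ioo a b, m ≤ g x) : m ≤ avgI g a b := by
  have h1 : avgI (fun x => - g x) a b ≤ -m :=
    avgI_le_of_le hab hg.neg fun x hx => neg_le_neg (h x hx)
  have h2 : avgI (fun x => - g x) a b = - avgI g a b := by
    simp [avgI, integral_neg]
  linarith

lemma avgI_eq_half_add {g : ℝ → ℝ} {a b c : ℝ} (hac : a < c) (hc : b - c = c - a)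
    (hg : IntegrableOn g (Ico a b)) :
    avgI g a b = (avgI g a c + avgI g c b) / 2 := by
  have hcb : c < b := by linarith
  have h : ∫ x in Ico a b, g x = (∫ x in Ico a c, g x) + ∫ x in Ico c b, g x := by
    rw [← Ico_union_Ico_eq_Ico hac.le hcb.le]
    refine setIntegral_union ?_ measurableSet_Ico
      (hg.mono_set (Ico_subset_Ico_right hcb.le)) (hg.mono_set (Ico_subset_Ico_left hac.le))
    exact Ico_disjoint_Ico_same
  have h2 : b - a = 2 * (c - a) := by linarith
  unfold avgI
  rw [h, hc, h2, mul_inv]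
  ring

/-! ### Dyadic intervals and the square function over `[0,1)` -/

lemma mem_dyadicI_iff {n k : ℤ} {x : ℝ} : x ∈ dyadicI n k ↔ ⌊x * (2:ℝ) ^ n⌋ = k := by
  have h : (0:ℝ) < 2 ^ n := by positivity
  rw [Int.floor_eq_iff, dyadicI, mem_Ico, zpow_neg, ← div_eq_mul_inv, ← div_eq_mul_inv,
    div_le_iff₀ h, lt_div_iff₀ h]

lemma floor_mul_two_ediv_two (t : ℝ) : ⌊t * 2⌋ / 2 = ⌊t⌋ := by
  have h := Int.floor_div_natCast (t * 2) 2
  rw [Nat.cast_ofNat, mul_div_cancel_right₀ _ two_ne_zero] at h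
  exact h.symm

/-- The martingale of dyadic averages of `g` along the intervals containing `x`. -/
def avgAt (g : ℝ → ℝ) (x : ℝ) (n : ℕ) : ℝ := avgD g n ⌊x * (2:ℝ) ^ (n:ℤ)⌋

lemma deltaD_of_notMem {g : ℝ → ℝ} {n k : ℤ} {x : ℝ} (hx : x ∉ dyadicI n k) :
    deltaD g n k x = 0 := by
  have hd : x * (2:ℝ) ^ (n + 1) = (x * (2:ℝ) ^ n) * 2 := by
    rw [zpow_add_one₀ (by norm_num)]; ring
  have key : ∀ j : ℤ, x ∈ dyadicI (n + 1) j → ⌊x * (2:ℝ) ^ n⌋ = j / 2 := by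
    intro j hj
    rw [mem_dyadicI_iff, hd] at hj
    rw [← hj, floor_mul_two_ediv_two]
  have h1 : x ∉ dyadicI (n + 1) (2 * k) := fun h => hx <| by
    rw [mem_dyadicI_iff, key _ h]; omega
  have h2 : x ∉ dyadicI (n + 1) (2 * k + 1) := fun h => hx <| by
    rw [mem_dyadicI_iff, key _ h]; omega
  simp [deltaD, h1, h2, hx]

lemma deltaD_floor (g : ℝ → ℝ) (n : ℕ) (x : ℝ) :
    deltaD g n ⌊x * (2:ℝ) ^ (n:ℤ)⌋ x = avgAt g x (n + 1) - avgAt g x n := by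
  set k := ⌊x * (2:ℝ) ^ (n:ℤ)⌋ with hk
  have hx : x ∈ dyadicI n k := mem_dyadicI_iff.2 rfl
  have hd : x * (2:ℝ) ^ ((n:ℤ) + 1) = (x * (2:ℝ) ^ (n:ℤ)) * 2 := by
    rw [zpow_add_one₀ (by norm_num)]; ring
  set m := ⌊x * (2:ℝ) ^ ((n:ℤ) + 1)⌋ with hm
  have hkm : k = m / 2 := by
    rw [hm, hd, floor_mul_two_ediv_two]
  have e1 : avgAt g x (n + 1) = avgD g ((n:ℤ) + 1) m := by
    simp [avgAt, hm]
  have e2 : avgAt g x n = avgD g n k := rfl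
  rw [e1, e2]
  rcases (by omega : m = 2 * k ∨ m = 2 * k + 1) with h | h
  · have h1 : x ∈ dyadicI ((n:ℤ) + 1) (2 * k) := mem_dyadicI_iff.2 h
    have h2 : x ∉ dyadicI ((n:ℤ) + 1) (2 * k + 1) := fun h' => by
      rw [mem_dyadicI_iff] at h'; omega
    simp [deltaD, h1, h2, hx, h]
  · have h1 : x ∈ dyadicI ((n:ℤ) + 1) (2 * k + 1) := mem_dyadicI_iff.2 h
    have h2 : x ∉ dyadicI ((n:ℤ) + 1) (2 * k) := fun h' => by
      rw [mem_dyadicI_iff] at h'; omega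
    simp [deltaD, h1, h2, hx, h]

lemma dyadicI_floor_subset {x : ℝ} (hx : x ∈ Ico (0:ℝ) 1) (n : ℕ) :
    dyadicI n ⌊x * (2:ℝ) ^ (n:ℤ)⌋ ⊆ Ico (0:ℝ) 1 := by
  have h2 : (0:ℝ) < 2 ^ (n:ℤ) := by positivity
  have h0 : (0:ℤ) ≤ ⌊x * (2:ℝ) ^ (n:ℤ)⌋ := Int.floor_nonneg.2 (mul_nonneg hx.1 h2.le)
  have h1 : ⌊x * (2:ℝ) ^ (n:ℤ)⌋ < 2 ^ n := by
    rw [Int.floor_lt]; push_cast; rw [zpow_natCast] at *; nlinarith [hx.2]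
  refine Ico_subset_Ico (by positivity) ?_
  rw [zpow_neg, ← div_eq_mul_inv, div_le_one h2]
  exact_mod_cast h1

lemma nonneg_of_dyadicI_subset {n k : ℤ} (h : dyadicI n k ⊆ Ico (0:ℝ) 1) : 0 ≤ n := by
  by_contra! hn
  have hpos : (0:ℝ) < 2 ^ (-n) := by positivity
  have h1 : (1:ℝ) < 2 ^ (-n) := one_lt_zpow₀ (by norm_num) (by omega)
  obtain ⟨h2, h3⟩ := (Ico_subset_Ico_iff (by nlinarith)).1 h
  nlinarith

lemma sqFn01_eq {g : ℝ → ℝ} {x : ℝ} (hx : x ∈ Ico (0:ℝ) 1) :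
    sqFn01 g x = √(∑' n : ℕ, (avgAt g x (n + 1) - avgAt g x n) ^ 2) := by
  classical
  unfold sqFn01
  congr 1
  let i : ℕ → ℤ × ℤ := fun n => ((n:ℤ), ⌊x * (2:ℝ) ^ (n:ℤ)⌋)
  have hi : Function.Injective i := fun a b hab => by
    have := congrArg Prod.fst hab
    simpa [i] using this
  rw [← hi.tsum_eq]
  · refine tsum_congr fun n => ?_
    simp only [i]
    rw [if_pos (dyadicI_floor_subset hx n), deltaD_floor]
  · rintro ⟨n, k⟩ hq
    simp only [Function.mem_support, ne_eq, ite_eq_right_iff, Classical.not_imp] at hq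
    obtain ⟨hs, hne⟩ := hq
    have hmem : x ∈ dyadicI n k := by
      by_contra hmem
      exact hne (by rw [deltaD_of_notMem hmem]; norm_num)
    lift n to ℕ using nonneg_of_dyadicI_subset hs
    exact ⟨n, by simp only [i]; rw [mem_dyadicI_iff.1 hmem]⟩

/-! ### The function with alternating signs -/

lemma avgAt_of_mem {g : ℝ → ℝ} {x : ℝ} {n : ℕ} (hx : x ∈ Ico (0:ℝ) (2 ^ (-(n:ℤ)))) :
    avgAt g x n = avgI g 0 (2 ^ (-(n:ℤ))) := by
  have h : x ∈ dyadicI n 0 := by simpa [dyadicI] using hx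
  rw [avgAt, mem_dyadicI_iff.1 h]
  simp [avgD]

lemma logb_two_zpow (m : ℤ) : Real.logb 2 ((2:ℝ) ^ m) = m := by
  rw [← Real.rpow_intCast, Real.logb_rpow (by norm_num) (by norm_num)]

lemma neg_logb_mem {y : ℝ} {n : ℕ} (hy : y ∈ Ioo ((2:ℝ) ^ (-((n:ℤ) + 1))) (2 ^ (-(n:ℤ)))) :
    -Real.logb 2 y ∈ Ioo (n:ℝ) (n + 1) := by
  have hy0 : 0 < y := lt_trans (by positivity) hy.1
  have h1 := (Real.logb_lt_logb_iff (b := 2) (by norm_num) (by positivity) hy0).2 hy.1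
  have h2 := (Real.logb_lt_logb_iff (b := 2) (by norm_num) hy0 (by positivity)).2 hy.2
  rw [logb_two_zpow] at h1 h2
  push_cast at h1 h2
  exact ⟨by linarith, by linarith⟩

/-- `g` agrees on `(0,1)` with `(-1)^{⌊-log₂ y⌋} (1 - log₂ y)^{-r}`. -/
def IsAlternatingLog (r : ℝ) (g : ℝ → ℝ) : Prop :=
  ∀ y ∈ Ioo (0:ℝ) 1, g y = (-1:ℝ) ^ ⌊-Real.logb 2 y⌋ * (1 - Real.logb 2 y) ^ (-r)

namespace IsAlternatingLog

variable {r : ℝ} {g : ℝ → ℝ}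

lemma abs_le (hg : IsAlternatingLog r g) (hr : 0 ≤ r) {n : ℕ} {y : ℝ}
    (hy : y ∈ Ioo (0:ℝ) (2 ^ (-(n:ℤ)))) : |g y| ≤ ((n:ℝ) + 1) ^ (-r) := by
  have hle : (2:ℝ) ^ (-(n:ℤ)) ≤ 1 := zpow_le_one_of_nonpos₀ (by norm_num) (by simp)
  have h2 := (Real.logb_lt_logb_iff (b := 2) (by norm_num) hy.1 (by positivity)).2 hy.2
  rw [logb_two_zpow] at h2
  push_cast at h2
  rw [hg y ⟨hy.1, hy.2.trans_le hle⟩, abs_mul, abs_zpow, abs_neg, abs_one, one_zpow, one_mul,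
    abs_of_nonneg (Real.rpow_nonneg (by linarith [n.cast_nonneg (α := ℝ)]) _)]
  exact Real.rpow_le_rpow_of_nonpos (by positivity) (by linarith) (by linarith)

lemma integrableOn (hg : IsAlternatingLog r g) (hr : 0 ≤ r) : IntegrableOn g (Ico 0 1) := by
  rw [integrableOn_Ico_iff_integrableOn_Ioo]
  have hm : Measurable fun y : ℝ => (-1:ℝ) ^ ⌊-Real.logb 2 y⌋ * (1 - Real.logb 2 y) ^ (-r) := by
    have hl : Measurable fun y : ℝ => Real.logb 2 y := by
      unfold Real.logb; fun_prop
    have h1 : Measurable fun y : ℝ => (-1:ℝ) ^ ⌊-Real.logb 2 y⌋ :=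
      (measurable_of_countable (fun z : ℤ => (-1:ℝ) ^ z)).comp hl.neg.floor
    exact h1.mul ((measurable_const.sub hl).pow_const _)
  refine IntegrableOn.of_bound (by simp) ?_ 1 ?_
  · refine hm.aestronglyMeasurable.congr ?_
    filter_upwards [ae_restrict_mem measurableSet_Ioo] with y hy using (hg y hy).symm
  · filter_upwards [ae_restrict_mem measurableSet_Ioo] with y hy
    simpa using hg.abs_le hr (n := 0) (by simpa using hy)

lemma eq_of_mem (hg : IsAlternatingLog r g) {n : ℕ} {y : ℝ}
    (hy : y ∈ Ioo ((2:ℝ) ^ (-((n:ℤ) + 1))) (2 ^ (-(n:ℤ)))) :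
    g y = (-1:ℝ) ^ n * (1 - Real.logb 2 y) ^ (-r) := by
  have hle : (2:ℝ) ^ (-(n:ℤ)) ≤ 1 := zpow_le_one_of_nonpos₀ (by norm_num) (by simp)
  have hfl : ⌊-Real.logb 2 y⌋ = (n:ℤ) := by
    rw [Int.floor_eq_iff]
    have := neg_logb_mem hy
    exact ⟨by exact_mod_cast this.1.le, by exact_mod_cast this.2⟩
  rw [hg y ⟨lt_trans (by positivity) hy.1, hy.2.trans_le hle⟩, hfl, zpow_natCast]

lemma integrableOn_Ico (hg : IsAlternatingLog r g) (hr : 0 ≤ r) {a b : ℝ} (ha : 0 ≤ a)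
    (hb : b ≤ 1) : IntegrableOn g (Ico a b) :=
  (hg.integrableOn hr).mono_set (Ico_subset_Ico ha hb)

lemma abs_avgI_le (hg : IsAlternatingLog r g) (hr : 0 ≤ r) (n : ℕ) :
    |avgI g 0 (2 ^ (-(n:ℤ)))| ≤ ((n:ℝ) + 1) ^ (-r) := by
  have hle : (2:ℝ) ^ (-(n:ℤ)) ≤ 1 := zpow_le_one_of_nonpos₀ (by norm_num) (by simp)
  have hi := hg.integrableOn_Ico hr le_rfl hle
  have h0 : (0:ℝ) < 2 ^ (-(n:ℤ)) := by positivity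
  exact _root_.abs_le.2 ⟨le_avgI_of_le h0 hi fun y hy => (_root_.abs_le.1 (hg.abs_le hr hy)).1,
    avgI_le_of_le h0 hi fun y hy => (_root_.abs_le.1 (hg.abs_le hr hy)).2⟩

lemma le_neg_one_pow_mul_avgI (hg : IsAlternatingLog r g) (hr : 0 ≤ r) (n : ℕ) :
    ((n:ℝ) + 2) ^ (-r) ≤ (-1) ^ n * avgI g (2 ^ (-((n:ℤ) + 1))) (2 ^ (-(n:ℤ))) := by
  have hle : (2:ℝ) ^ (-(n:ℤ)) ≤ 1 := zpow_le_one_of_nonpos₀ (by norm_num) (by simp)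
  have hlt : (2:ℝ) ^ (-((n:ℤ) + 1)) < 2 ^ (-(n:ℤ)) :=
    zpow_lt_zpow_right₀ (by norm_num) (by omega)
  have hi := hg.integrableOn_Ico hr (a := 2 ^ (-((n:ℤ) + 1))) (by positivity) hle
  have e : (-1) ^ n * avgI g (2 ^ (-((n:ℤ) + 1))) (2 ^ (-(n:ℤ))) =
      avgI (fun y => (-1) ^ n * g y) (2 ^ (-((n:ℤ) + 1))) (2 ^ (-(n:ℤ))) := by
    unfold avgI
    rw [integral_const_mul]
    ring
  rw [e]
  refine le_avgI_of_le hlt (hi.const_mul _) fun y hy => ?_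
  have hl := neg_logb_mem hy
  rw [hg.eq_of_mem hy, ← mul_assoc, ← mul_pow]
  norm_num
  exact Real.rpow_le_rpow_of_nonpos (by linarith [hl.1, n.cast_nonneg (α := ℝ)])
    (by linarith [hl.2]) (by linarith)

lemma avgI_zero_eq (hg : IsAlternatingLog r g) (hr : 0 ≤ r) (n : ℕ) :
    avgI g 0 (2 ^ (-(n:ℤ))) = (avgI g 0 (2 ^ (-((n:ℤ) + 1))) +
      avgI g (2 ^ (-((n:ℤ) + 1))) (2 ^ (-(n:ℤ)))) / 2 := by
  have hle : (2:ℝ) ^ (-(n:ℤ)) ≤ 1 := zpow_le_one_of_nonpos₀ (by norm_num) (by simp)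
  refine avgI_eq_half_add (by positivity) ?_ (hg.integrableOn_Ico hr le_rfl hle)
  have : (2:ℝ) ^ (-(n:ℤ)) = 2 ^ (-((n:ℤ) + 1)) * 2 := by
    rw [← zpow_add_one₀ (by norm_num)]; congr 1; ring
  rw [this]; ring

/-- The averages over `[0, 2^{-n})` inherit the sign of `g` on the right half. -/
lemma neg_one_pow_mul_avgI_zero_nonneg (hg : IsAlternatingLog r g) (hr : 0 ≤ r) (n : ℕ) :
    0 ≤ (-1) ^ n * avgI g 0 (2 ^ (-(n:ℤ))) := by
  have h1 := hg.le_neg_one_pow_mul_avgI hr n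
  have h2 := hg.abs_avgI_le hr (n + 1)
  push_cast at h2
  rw [show (n:ℝ) + 1 + 1 = n + 2 by ring] at h2
  rw [hg.avgI_zero_eq hr n]
  obtain ⟨h3, h4⟩ := _root_.abs_le.1 h2
  rcases neg_one_pow_eq_or ℝ n with h | h <;> rw [h] at h1 ⊢ <;> linarith

lemma le_sq_avgI_sub (hg : IsAlternatingLog r g) (hr : 0 ≤ r) (n : ℕ) :
    (((n:ℝ) + 2) ^ (-r) / 2) ^ 2 ≤
      (avgI g 0 (2 ^ (-((n:ℤ) + 1))) - avgI g 0 (2 ^ (-(n:ℤ)))) ^ 2 := by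
  have h1 := hg.le_neg_one_pow_mul_avgI hr n
  have h2 := hg.neg_one_pow_mul_avgI_zero_nonneg hr (n + 1)
  have h3 : 0 ≤ ((n:ℝ) + 2) ^ (-r) := by positivity
  push_cast at h2
  rw [pow_succ] at h2
  rw [hg.avgI_zero_eq hr n, sq_le_sq, abs_of_nonneg (by positivity)]
  rcases neg_one_pow_eq_or ℝ n with h | h <;> rw [h] at h1 h2
  · refine le_trans ?_ (neg_le_abs _); linarith
  · refine le_trans ?_ (le_abs_self _); linarith

lemma summable_sq (hg : IsAlternatingLog r g) (hr : 0 ≤ r) {N : ℕ} {x : ℝ}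
    (hx : x ∈ Ico ((2:ℝ) ^ (-((N:ℤ) + 1))) (2 ^ (-(N:ℤ)))) :
    Summable fun n : ℕ => (avgAt g x (n + 1) - avgAt g x n) ^ 2 := by
  set a : ℝ := 2 ^ (-((N:ℤ) + 1)) with ha
  set b : ℝ := 2 ^ (-(N:ℤ)) with hb
  have hb1 : b ≤ 1 := zpow_le_one_of_nonpos₀ (by norm_num) (by simp)
  have ha0 : 0 < a := by positivity
  have hC : ContDiffOn ℝ 1 (fun y : ℝ => (-1:ℝ) ^ N * (1 - Real.logb 2 y) ^ (-r)) (Icc a b) := by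
    intro y hy
    have hy0 : 0 < y := ha0.trans_le hy.1
    have hl : Real.logb 2 y ≤ 0 := Real.logb_nonpos (by norm_num) hy0.le (hy.2.trans hb1)
    have h1 : ContDiffAt ℝ 1 (fun y : ℝ => Real.logb 2 y) y := by
      unfold Real.logb
      exact (Real.contDiffAt_log.2 hy0.ne').div_const _
    have h2 : ContDiffAt ℝ 1 (fun y : ℝ => 1 - Real.logb 2 y) y := contDiffAt_const.sub h1
    exact (contDiffAt_const.mul
      (h2.rpow_const_of_ne (by linarith : 1 - Real.logb 2 y ≠ 0))).contDiffWithinAt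
  obtain ⟨K, hK⟩ := hC.exists_lipschitzOnWith (by norm_num) (convex_Icc a b) isCompact_Icc
  set c : ℝ := (-1:ℝ) ^ N * (1 - Real.logb 2 x) ^ (-r) with hc
  have key : ∀ n : ℕ, N + 1 ≤ n → |avgAt g x n - c| ≤ K * 2 ^ (-(n:ℤ)) := by
    intro n hn
    set k := ⌊x * (2:ℝ) ^ (n:ℤ)⌋ with hk
    have hxm : x ∈ dyadicI n k := mem_dyadicI_iff.2 rfl
    have hpos : (0:ℝ) < 2 ^ (-(n:ℤ)) := by positivity
    have hpos' : (0:ℝ) < 2 ^ (n:ℤ) := by positivity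
    have hinv : (2:ℝ) ^ (-(n:ℤ)) * 2 ^ (n:ℤ) = 1 := by
      rw [← zpow_add₀ (by norm_num)]; simp
    have ea : a = (((2:ℤ) ^ (n - (N + 1)) : ℤ) : ℝ) * 2 ^ (-(n:ℤ)) := by
      push_cast
      rw [← zpow_natCast, ← zpow_add₀ (by norm_num), ha]
      congr 1; omega
    have eb : b = (((2:ℤ) ^ (n - N) : ℤ) : ℝ) * 2 ^ (-(n:ℤ)) := by
      push_cast
      rw [← zpow_natCast, ← zpow_add₀ (by norm_num), hb]
      congr 1; omega
    have hka : (2:ℤ) ^ (n - (N + 1)) ≤ k := by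
      rw [hk, Int.le_floor]
      have := mul_le_mul_of_nonneg_right hx.1 hpos'.le
      rwa [ea, mul_assoc, hinv, mul_one] at this
    have hkb : k < (2:ℤ) ^ (n - N) := by
      rw [hk, Int.floor_lt]
      have := mul_lt_mul_of_pos_right hx.2 hpos'
      rwa [eb, mul_assoc, hinv, mul_one] at this
    have hla : a ≤ (k:ℝ) * 2 ^ (-(n:ℤ)) := by
      rw [ea]; exact mul_le_mul_of_nonneg_right (by exact_mod_cast hka) hpos.le
    have hlb : ((k:ℝ) + 1) * 2 ^ (-(n:ℤ)) ≤ b := by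
      rw [eb]; exact mul_le_mul_of_nonneg_right (by exact_mod_cast hkb) hpos.le
    have hlt : (k:ℝ) * 2 ^ (-(n:ℤ)) < ((k:ℝ) + 1) * 2 ^ (-(n:ℤ)) := by nlinarith
    have hint := hg.integrableOn_Ico hr (ha0.le.trans hla) (hlb.trans hb1)
    have hbd : ∀ y ∈ Ioo ((k:ℝ) * 2 ^ (-(n:ℤ))) (((k:ℝ) + 1) * 2 ^ (-(n:ℤ))),
        |g y - c| ≤ K * 2 ^ (-(n:ℤ)) := by
      intro y hy
      have hya : y ∈ Ioo a b := ⟨hla.trans_lt hy.1, hy.2.trans_le hlb⟩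
      rw [hg.eq_of_mem hya]
      have := hK.dist_le_mul y (Ioo_subset_Icc_self hya) x (Ico_subset_Icc_self hx)
      rw [Real.dist_eq, Real.dist_eq] at this
      refine this.trans (mul_le_mul_of_nonneg_left ?_ K.coe_nonneg)
      have h1 := hxm.1
      have h2 := hxm.2
      rw [_root_.abs_le]
      constructor <;> nlinarith [hy.1, hy.2]
    have hlow := le_avgI_of_le hlt hint (m := c - K * 2 ^ (-(n:ℤ))) fun y hy => by
      linarith [(_root_.abs_le.1 (hbd y hy)).1]
    have hup := avgI_le_of_le hlt hint (M := c + K * 2 ^ (-(n:ℤ))) fun y hy => by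
      linarith [(_root_.abs_le.1 (hbd y hy)).2]
    have e : avgAt g x n = avgI g ((k:ℝ) * 2 ^ (-(n:ℤ))) (((k:ℝ) + 1) * 2 ^ (-(n:ℤ))) := rfl
    rw [e, _root_.abs_le]
    constructor <;> linarith
  rw [← summable_nat_add_iff (N + 1)]
  have hgeo : Summable fun n : ℕ => (2 * (K:ℝ)) ^ 2 * ((1/4:ℝ)) ^ (n + (N + 1)) :=
    ((summable_nat_add_iff (N + 1)).2
      (summable_geometric_of_lt_one (by norm_num) (by norm_num))).mul_left _
  refine Summable.of_nonneg_of_le (fun _ => sq_nonneg _) (fun n => ?_) hgeo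
  have h1 := key (n + (N + 1)) (by omega)
  have h2 := key (n + (N + 1) + 1) (by omega)
  have h3 : (2:ℝ) ^ (-((n + (N + 1) + 1 : ℕ):ℤ)) ≤ 2 ^ (-((n + (N + 1) : ℕ):ℤ)) :=
    zpow_le_zpow_right₀ (by norm_num) (by push_cast; omega)
  have h4 : |avgAt g x (n + (N + 1) + 1) - avgAt g x (n + (N + 1))| ≤
      2 * K * 2 ^ (-((n + (N + 1) : ℕ):ℤ)) := by
    have h5 := mul_le_mul_of_nonneg_left h3 K.coe_nonneg
    rw [_root_.abs_le] at *
    constructor <;> linarith [h1.1, h1.2, h2.1, h2.2]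
  have h6 : ((2:ℝ) ^ (-((n + (N + 1) : ℕ):ℤ))) ^ 2 = (1/4) ^ (n + (N + 1)) := by
    rw [zpow_neg, zpow_natCast, ← inv_pow, ← pow_mul, mul_comm, pow_mul]; norm_num
  calc _ = |avgAt g x (n + (N + 1) + 1) - avgAt g x (n + (N + 1))| ^ 2 := (sq_abs _).symm
    _ ≤ (2 * K * 2 ^ (-((n + (N + 1) : ℕ):ℤ))) ^ 2 := pow_le_pow_left₀ (abs_nonneg _) h4 2
    _ = _ := by rw [mul_pow, h6]

lemma le_sqFn01 (hg : IsAlternatingLog r g) (hr : 0 ≤ r) {N : ℕ} {x : ℝ}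
    (hx : x ∈ Ico ((2:ℝ) ^ (-((N:ℤ) + 1))) (2 ^ (-(N:ℤ)))) :
    √(N * (((N:ℝ) + 1) ^ (-r) / 2) ^ 2) ≤ sqFn01 g x := by
  have hb1 : (2:ℝ) ^ (-(N:ℤ)) ≤ 1 := zpow_le_one_of_nonpos₀ (by norm_num) (by simp)
  have hx0 : 0 ≤ x := le_trans (by positivity) hx.1
  rw [sqFn01_eq ⟨hx0, hx.2.trans_le hb1⟩]
  refine Real.sqrt_le_sqrt ?_
  refine le_trans ?_ ((hg.summable_sq hr hx).sum_le_tsum (Finset.range N)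
    fun _ _ => sq_nonneg _)
  have : (N:ℝ) * (((N:ℝ) + 1) ^ (-r) / 2) ^ 2 =
      ∑ _n ∈ Finset.range N, (((N:ℝ) + 1) ^ (-r) / 2) ^ 2 := by simp
  rw [this]
  refine Finset.sum_le_sum fun n hn => ?_
  have hn : n + 1 ≤ N := Finset.mem_range.1 hn
  have hm : ∀ m : ℕ, m ≤ N → x ∈ Ico (0:ℝ) (2 ^ (-(m:ℤ))) := fun m hm =>
    ⟨hx0, hx.2.trans_le (zpow_le_zpow_right₀ (by norm_num) (by omega))⟩
  rw [avgAt_of_mem (hm n (by omega)), avgAt_of_mem (hm (n + 1) hn)]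
  push_cast
  refine le_trans ?_ (hg.le_sq_avgI_sub hr n)
  have : ((N:ℝ) + 1) ^ (-r) ≤ ((n:ℝ) + 2) ^ (-r) :=
    Real.rpow_le_rpow_of_nonpos (by positivity)
      (by have : (n:ℝ) + 1 ≤ N := by exact_mod_cast hn
          linarith) (by linarith)
  gcongr

lemma le_sqFn01_rpow (hg : IsAlternatingLog r g) (hr : 0 ≤ r) (hr2 : r ≤ 1/2) {p : ℝ}
    (hp : 2 ≤ p) {N : ℕ} (hN : 1 ≤ N) {x : ℝ}
    (hx : x ∈ Ico ((2:ℝ) ^ (-((N:ℤ) + 1))) (2 ^ (-(N:ℤ)))) :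
    (1/8) ^ (p/2) * ((N:ℝ) + 1) ^ (1 - 2*r) ≤ sqFn01 g x ^ p := by
  have hN' : (1:ℝ) ≤ N := by exact_mod_cast hN
  have hM : (0:ℝ) < (N:ℝ) + 1 := by positivity
  have e : ((N:ℝ) + 1) ^ (1 - 2*r) = (N + 1) * (((N:ℝ) + 1) ^ (-r)) ^ 2 := by
    rw [← Real.rpow_natCast (((N:ℝ) + 1) ^ (-r)), ← Real.rpow_mul hM.le]
    nth_rw 2 [← Real.rpow_one ((N:ℝ) + 1)]
    rw [← Real.rpow_add hM]
    congr 1; push_cast; ring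
  have h1 : (1/8) * ((N:ℝ) + 1) ^ (1 - 2*r) ≤ N * (((N:ℝ) + 1) ^ (-r) / 2) ^ 2 := by
    rw [e]
    nlinarith [sq_nonneg (((N:ℝ) + 1) ^ (-r))]
  have h0 : 1 ≤ ((N:ℝ) + 1) ^ (1 - 2*r) := Real.one_le_rpow (by linarith) (by linarith)
  calc (1/8) ^ (p/2) * ((N:ℝ) + 1) ^ (1 - 2*r)
      ≤ (1/8) ^ (p/2) * (((N:ℝ) + 1) ^ (1 - 2*r)) ^ (p/2) := by
        gcongr
        exact Real.self_le_rpow_of_one_le h0 (by linarith)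
    _ = ((1/8) * ((N:ℝ) + 1) ^ (1 - 2*r)) ^ (p/2) := by
        rw [Real.mul_rpow (by norm_num) (by positivity)]
    _ = √((1/8) * ((N:ℝ) + 1) ^ (1 - 2*r)) ^ p := by
        rw [Real.sqrt_eq_rpow, ← Real.rpow_mul (by positivity)]
        congr 1; ring
    _ ≤ sqFn01 g x ^ p := by
        refine Real.rpow_le_rpow (Real.sqrt_nonneg _) ?_ (by linarith)
        exact (Real.sqrt_le_sqrt h1).trans (hg.le_sqFn01 hr hx)

end IsAlternatingLog

/-! ### Divergence -/

lemma le_weight {r : ℝ} (hr : r ≤ 1/2) {N : ℕ} {x : ℝ}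
    (hx : x ∈ Ico ((2:ℝ) ^ (-((N:ℤ) + 1))) (2 ^ (-(N:ℤ)))) :
    (2 ^ (-(N:ℤ)) * (2 * ((N:ℝ) + 1)) ^ (2 - 2*r))⁻¹ ≤
      (x * (1 - Real.logb 2 x) ^ (1 - (2*r - 1)))⁻¹ := by
  have hb1 : (2:ℝ) ^ (-(N:ℤ)) ≤ 1 := zpow_le_one_of_nonpos₀ (by norm_num) (by simp)
  have hx0 : 0 < x := lt_of_lt_of_le (by positivity) hx.1
  have hl : Real.logb 2 x ≤ 0 :=
    Real.logb_nonpos (by norm_num) hx0.le (hx.2.le.trans hb1)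
  have h1 := (Real.logb_le_logb (b := 2) (by norm_num) (by positivity) hx0).2 hx.1
  rw [logb_two_zpow] at h1
  push_cast at h1
  have hpos : 0 < 1 - Real.logb 2 x := by linarith
  rw [show 1 - (2*r - 1) = 2 - 2*r by ring]
  refine inv_anti₀ (by positivity) ?_
  have h3 : 1 - Real.logb 2 x ≤ 2 * ((N:ℝ) + 1) := by
    linarith [N.cast_nonneg (α := ℝ)]
  have h4 : (1 - Real.logb 2 x) ^ (2 - 2*r) ≤ (2 * ((N:ℝ) + 1)) ^ (2 - 2*r) :=
    Real.rpow_le_rpow hpos.le h3 (by linarith)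
  exact mul_le_mul hx.2.le h4 (by positivity) (by positivity)

/-- If `F` is at least `c 2^N / (N+1)` on `[2^{-N-1}, 2^{-N})` for all `N ≥ 1`, then `F` has
infinite integral near `0`. -/
lemma lintegral_eq_top_of_le {F : ℝ → ℝ} {c : ℝ} (hc : 0 < c)
    (hF : ∀ N : ℕ, 1 ≤ N → ∀ x ∈ Ico ((2:ℝ) ^ (-((N:ℤ) + 1))) (2 ^ (-(N:ℤ))),
      c * 2 ^ (N:ℤ) / ((N:ℝ) + 1) ≤ F x) (k : ℕ) :
    ∫⁻ x in Ico (0:ℝ) (2 ^ (-(k:ℤ))), ENNReal.ofReal (F x) = ⊤ := by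
  set I : ℕ → Set ℝ := fun j =>
    Ico ((2:ℝ) ^ (-(((j + (k + 1) : ℕ):ℤ) + 1))) (2 ^ (-((j + (k + 1) : ℕ):ℤ))) with hI
  have hsub : (⋃ j, I j) ⊆ Ico (0:ℝ) (2 ^ (-(k:ℤ))) := by
    refine iUnion_subset fun j => Ico_subset_Ico (by positivity) ?_
    exact zpow_le_zpow_right₀ (by norm_num) (by push_cast; omega)
  have hdisj : Pairwise (Function.onFun Disjoint I) := by
    refine (pairwise_disjoint_on I).2 fun i j hij => ?_
    refine Set.disjoint_left.2 fun x hxi hxj => ?_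
    have : (2:ℝ) ^ (-((j + (k + 1) : ℕ):ℤ)) ≤ 2 ^ (-(((i + (k + 1) : ℕ):ℤ) + 1)) :=
      zpow_le_zpow_right₀ (by norm_num) (by push_cast; omega)
    exact absurd (hxj.2.trans_le this) (not_lt.2 hxi.1)
  have hterm : ∀ j, ENNReal.ofReal (c / 2 * (1 / ((j + (k + 1) : ℕ) + 1 : ℝ))) ≤
      ∫⁻ x in I j, ENNReal.ofReal (F x) := by
    intro j
    set N := j + (k + 1) with hN
    have hpos : (0:ℝ) < 2 ^ (N:ℤ) := by positivity
    calc _ = ∫⁻ _ in I j, ENNReal.ofReal (c * 2 ^ (N:ℤ) / ((N:ℝ) + 1)) := by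
          rw [setLIntegral_const, hI, Real.volume_Ico, ← ENNReal.ofReal_mul (by positivity)]
          congr 1
          rw [neg_add, zpow_add₀ (by norm_num), zpow_neg]
          rw [← hN]
          field_simp
          norm_num
      _ ≤ _ := setLIntegral_mono' measurableSet_Ico fun x hx =>
          ENNReal.ofReal_le_ofReal (hF N (by omega) x hx)
  have hns : ¬ Summable fun j : ℕ => c / 2 * (1 / ((j + (k + 1) : ℕ) + 1 : ℝ)) := by
    rw [summable_mul_left_iff (by positivity)]
    have h := Real.not_summable_one_div_natCast
    rw [← summable_nat_add_iff (k + 2)] at h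
    refine fun hs => h (hs.congr fun j => ?_)
    push_cast
    ring_nf
  have htop : ∑' j : ℕ, ENNReal.ofReal (c / 2 * (1 / ((j + (k + 1) : ℕ) + 1 : ℝ))) = ⊤ := by
    by_contra h
    refine hns ?_
    have := ENNReal.summable_toReal h
    refine this.congr fun j => ?_
    rw [ENNReal.toReal_ofReal (by positivity)]
  rw [eq_top_iff, ← htop]
  calc _ ≤ ∑' j, ∫⁻ x in I j, ENNReal.ofReal (F x) := ENNReal.tsum_le_tsum hterm
    _ = ∫⁻ x in ⋃ j, I j, ENNReal.ofReal (F x) :=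
        (lintegral_iUnion (fun j => measurableSet_Ico) hdisj _).symm
    _ ≤ _ := lintegral_mono_set hsub

lemma IsAlternatingLog.le_sqFn01_rpow_mul_weight {r p : ℝ} {g : ℝ → ℝ}
    (hg : IsAlternatingLog r g) (hr : 0 ≤ r) (hr2 : r ≤ 1/2) (hp : 2 ≤ p) {N : ℕ}
    (hN : 1 ≤ N) {x : ℝ} (hx : x ∈ Ico ((2:ℝ) ^ (-((N:ℤ) + 1))) (2 ^ (-(N:ℤ)))) :
    ((1/8) ^ (p/2) * (2 ^ (2 - 2*r))⁻¹) * 2 ^ (N:ℤ) / ((N:ℝ) + 1) ≤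
      sqFn01 g x ^ p *
        (if x = 0 then 1 else (x * (1 - Real.logb 2 x) ^ (1 - (2*r - 1)))⁻¹) := by
  have hx0 : 0 < x := lt_of_lt_of_le (by positivity) hx.1
  have hM : (0:ℝ) < (N:ℝ) + 1 := by positivity
  rw [if_neg hx0.ne']
  refine le_trans (le_of_eq ?_) (mul_le_mul (hg.le_sqFn01_rpow hr hr2 hp hN hx)
    (le_weight hr2 hx) (by positivity) (Real.rpow_nonneg (Real.sqrt_nonneg _) _))
  rw [Real.mul_rpow (by norm_num) hM.le, show 2 - 2*r = (1 - 2*r) + 1 by ring,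
    Real.rpow_add_one hM.ne', zpow_neg]
  have : ((N:ℝ) + 1) ^ (1 - 2*r) ≠ 0 := (Real.rpow_pos_of_pos hM _).ne'
  field_simp

lemma isAlternatingLog_mul (s r : ℝ) :
    IsAlternatingLog r (fun y =>
      (if y = 0 then 1 else y ^ s) *
        (if y = 0 then 1
          else (-1:ℝ) ^ ⌊-Real.logb 2 y⌋ * y ^ (-s) * (1 - Real.logb 2 y) ^ (-r))) := by
  intro y hy
  have h : y ^ s * y ^ (-s) = 1 := by rw [← Real.rpow_add hy.1]; simp
  simp only [hy.1.ne', if_false]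
  linear_combination ((-1:ℝ) ^ ⌊-Real.logb 2 y⌋ * (1 - Real.logb 2 y) ^ (-r)) * h

/-- For `p ∈ (2,∞)`, `r ∈ (1/p,1/2)`, `α = 2r-1`, and
`f(x) = (-1)^{⌊-log₂ x⌋} x^{-1/(p-1)} (1-log₂ x)^{-r}`, `σ(x) = x^{1/(p-1)}`,
`w(x) = 1/(x (1-log₂ x)^{1-α})` on `(0,1)` (value `1` at `0`), the integrals
`∫_{[0,2^{-k})} S(σf)^p w` tend to `∞` as `k → ∞`; in particular `S(σf) ∉ L^p(w)`,
where `S` is the dyadic square function over `[0,1)`. -/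
theorem statement16 (p r : ℝ) (hp : 2 < p) (hr : r ∈ Set.Ioo (1/p) (1/2 : ℝ)) :
    Filter.Tendsto
      (fun k : ℕ =>
        ∫⁻ x in Set.Ico (0:ℝ) ((2:ℝ) ^ (-(k:ℤ))),
          ENNReal.ofReal
            ((sqFn01 (fun y =>
                (if y = 0 then 1 else y ^ (1/(p - 1))) *
                  (if y = 0 then 1
                    else (-1:ℝ) ^ ⌊-Real.logb 2 y⌋ * y ^ (-(1/(p - 1))) *
                      (1 - Real.logb 2 y) ^ (-r))) x) ^ p *
              (if x = 0 then 1 else (x * (1 - Real.logb 2 x) ^ (1 - (2*r - 1)))⁻¹)))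
      Filter.atTop (nhds ⊤) ∧
    pNorm01 p
        (sqFn01 (fun y =>
          (if y = 0 then 1 else y ^ (1/(p - 1))) *
            (if y = 0 then 1
              else (-1:ℝ) ^ ⌊-Real.logb 2 y⌋ * y ^ (-(1/(p - 1))) *
                (1 - Real.logb 2 y) ^ (-r))))
        (fun x => if x = 0 then 1 else (x * (1 - Real.logb 2 x) ^ (1 - (2*r - 1)))⁻¹) =
      ⊤ := by

  have hr0 : 0 ≤ r := (lt_trans (by positivity) hr.1).le
  have hg := isAlternatingLog_mul (1/(p - 1)) r
  have htop := fun k : ℕ => lintegral_eq_top_of_le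
    (c := (1/8) ^ (p/2) * (2 ^ (2 - 2*r))⁻¹) (by positivity)
    (fun N hN x hx => hg.le_sqFn01_rpow_mul_weight hr0 hr.2.le hp.le hN hx) k
  refine ⟨?_, ?_⟩
  · simp only [htop]
    exact tendsto_const_nhds
  · have h0 := htop 0
    simp only [Nat.cast_zero, neg_zero, zpow_zero] at h0
    unfold pNorm01
    simp only [abs_of_nonneg (Real.sqrt_nonneg _), sqFn01] at h0 ⊢
    rw [h0]
    exact ENNReal.top_rpow_of_pos (by positivity)

end
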